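/- arXiv:1407.7010 — 3 statements merged into one kernel-verified Lean document; each statement's English description precedes it below -/
import Mathlib

section
/- For all nonempty words ξ, ζ over 𝒜, the formula ▷ → \overleftarrow{ξ} ∨ \overrightarrow{ζ} is derivable from the set of axioms R1 (for all letters a ∈ 𝒜) together with the formula ▷ → \overrightarrow{ξ} ∨ \overrightarrow{ζ}, by modus ponens and substitution. -/
/-- Propositional formulas over the signature {→}. -/
inductive Fm : Type
  | var : ℕ → Fm
  | imp : Fm → Fm → Fm
  deriving DecidableEq

/-- Apply a substitution (uniform replacement of variables by formulas). -/
def Fm.subst (σ : ℕ → Fm) : Fm → Fm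
  | var n => σ n
  | imp A B => imp (A.subst σ) (B.subst σ)

/-- Derivability from a set of axioms by modus ponens and substitution. -/
inductive Deriv (P : Set Fm) : Fm → Prop
  | ax {A : Fm} : A ∈ P → Deriv P A
  | mp {A B : Fm} : Deriv P A → Deriv P (A.imp B) → Deriv P B
  | subst (σ : ℕ → Fm) {A : Fm} : Deriv P A → Deriv P (A.subst σ)

/-- The fixed variable x⁰. -/
def x0 : Fm := Fm.var 0

/-- Axioms of the intuitionistic implicational calculus Int_{→}:
A1: x → (y → x), A2: (x → (y → z)) → ((x → y) → (x → z)). -/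
def IntAx : Set Fm :=
  { Fm.imp (Fm.var 0) (Fm.imp (Fm.var 1) (Fm.var 0)),
    Fm.imp (Fm.imp (Fm.var 0) (Fm.imp (Fm.var 1) (Fm.var 2)))
      (Fm.imp (Fm.imp (Fm.var 0) (Fm.var 1)) (Fm.imp (Fm.var 0) (Fm.var 2))) }

/-- A ∨ B abbreviates (A → B) → B. -/
def orF (A B : Fm) : Fm := (A.imp B).imp B

/-- E 0 = x⁰ → x⁰ (i.e. E_1), E (k+1) = E k → x⁰. -/
def E : ℕ → Fm
  | 0 => x0.imp x0
  | n + 1 => (E n).imp x0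

/-- The code of the letter a_i (letters are elements of `Fin m`). -/
def code {m : ℕ} (i : Fin m) : Fm := (E i.val).imp (x0.imp (x0.imp x0))

/-- The formula ▷ = ((x⁰ → x⁰) → x⁰) → x⁰. -/
def tri : Fm := ((x0.imp x0).imp x0).imp x0

/-- Right-nested disjunction of a nonempty list of formulas. -/
def rlist : List Fm → Fm
  | [] => x0
  | [A] => A
  | A :: B :: Bs => orF A (rlist (B :: Bs))

def llistAux : Fm → List Fm → Fm
  | A, [] => A
  | A, B :: Bs => llistAux (orF A B) Bs

/-- Left-nested disjunction of a nonempty list of formulas. -/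
def llist : List Fm → Fm
  | [] => x0
  | A :: As => llistAux A As

/-- \overrightarrow{α}: right-nested disjunction of codes of the letters of α. -/
def rword {m : ℕ} (w : List (Fin m)) : Fm := rlist (w.map code)

/-- \overleftarrow{α}: left-nested disjunction of codes of the letters of α. -/
def lword {m : ℕ} (w : List (Fin m)) : Fm := llist (w.map code)

/-- A substitution instance of a member of M. -/
def SubStar (M : Set Fm) : Set Fm := {F | ∃ A ∈ M, ∃ σ : ℕ → Fm, F = Fm.subst σ A}

/-- Two formulas are unifiable if they have a common substitution instance. -/
def Unifiable (A B : Fm) : Prop := ∃ σ τ : ℕ → Fm, Fm.subst σ A = Fm.subst τ B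

/-- The variable v occurs in a formula. -/
def Occurs (v : ℕ) : Fm → Prop
  | Fm.var w => v = w
  | Fm.imp A B => Occurs v A ∨ Occurs v B

/-- Alphabetic formulas (𝒜-formulas) over the alphabet `Fin m`. -/
inductive AForm (m : ℕ) : Fm → Prop
  | ofCode (i : Fin m) : AForm m (code i)
  | ofOr {A B : Fm} : AForm m A → AForm m B → AForm m (orF A B)

/-- A tag system ⟨𝒜, 𝒲, d⟩ with 𝒜 = Fin m. -/
structure TagSystem where
  m : ℕ
  W : Fin m → List (Fin m)
  d : ℕ

/-- One production step of the tag system: a_i β γ ↦ γ ω_i, |β| = d - 1. -/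
def TagStep (T : TagSystem) (ξ ζ : List (Fin T.m)) : Prop :=
  ∃ (i : Fin T.m) (β γ : List (Fin T.m)),
    β.length = T.d - 1 ∧ ξ = i :: (β ++ γ) ∧ ζ = γ ++ T.W i

/-- ⟹_T : reflexive–transitive closure of the one-step production. -/
def TagSteps (T : TagSystem) : List (Fin T.m) → List (Fin T.m) → Prop :=
  Relation.ReflTransGen (TagStep T)

/-- T halts on α: α produces some word shorter than d. -/
def Halts (T : TagSystem) (α : List (Fin T.m)) : Prop :=
  ∃ β, TagSteps T α β ∧ β.length < T.d

/-- Axioms R1: (▷ → (y ∨ \overrightarrow{az}) ∨ u) → (▷ → (\overleftarrow{ya} ∨ z) ∨ u),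
with y = var 1, z = var 2, u = var 3. -/
def R1Ax (m : ℕ) : Set Fm :=
  {F | ∃ a : Fin m, F =
    (tri.imp (orF (orF (Fm.var 1) (orF (code a) (Fm.var 2))) (Fm.var 3))).imp
      (tri.imp (orF (orF (orF (Fm.var 1) (code a)) (Fm.var 2)) (Fm.var 3)))}

/-- Axioms R2: (▷ → \overleftarrow{ya} ∨ z) → (▷ → y ∨ \overrightarrow{az}). -/
def R2Ax (m : ℕ) : Set Fm :=
  {F | ∃ a : Fin m, F =
    (tri.imp (orF (orF (Fm.var 1) (code a)) (Fm.var 2))).imp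
      (tri.imp (orF (Fm.var 1) (orF (code a) (Fm.var 2))))}

/-- Axioms T1: (▷ → \overrightarrow{a_i α y}) → (▷ → \overrightarrow{y ω_i}), |α| = d - 1. -/
def T1Ax (T : TagSystem) : Set Fm :=
  {F | ∃ (i : Fin T.m) (α : List (Fin T.m)), α.length = T.d - 1 ∧
    F = (tri.imp (rlist (((i :: α).map code) ++ [Fm.var 1]))).imp
      (tri.imp (rlist (Fm.var 1 :: (T.W i).map code)))}

/-- Axioms T2: (▷ → \overrightarrow{a_i α}) → (▷ → \overrightarrow{ω_i}), |α| = d - 1. -/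
def T2Ax (T : TagSystem) : Set Fm :=
  {F | ∃ (i : Fin T.m) (α : List (Fin T.m)), α.length = T.d - 1 ∧
    F = (tri.imp (rword (i :: α))).imp (tri.imp (rword (T.W i)))}

/-- P_T = T1 ∪ T2 ∪ R1 ∪ R2. -/
def PT (T : TagSystem) : Set Fm := T1Ax T ∪ T2Ax T ∪ R1Ax T.m ∪ R2Ax T.m

/-- Axioms H: (▷ → \overrightarrow{α}) → A for 0 < |α| < d and A ∈ P₀. -/
def HAx (T : TagSystem) (P₀ : Finset Fm) : Set Fm :=
  {F | ∃ (α : List (Fin T.m)) (A : Fm), 0 < α.length ∧ α.length < T.d ∧ A ∈ P₀ ∧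
    F = (tri.imp (rword α)).imp A}

/-- P_{T,P₀} = P_T ∪ H. -/
def PTP (T : TagSystem) (P₀ : Finset Fm) : Set Fm := PT T ∪ HAx T P₀

/-- The calculus P_{T,ω,P₀} = {W_ω} ∪ P_T ∪ H. -/
def PTot (T : TagSystem) (ω : List (Fin T.m)) (P₀ : Finset Fm) : Set Fm :=
  insert (tri.imp (rword ω)) (PTP T P₀)

/-- Code(α): the four types of codes of a nonempty word α. -/
def CodeSet {m : ℕ} (α : List (Fin m)) : Set Fm :=
  {F | F = tri.imp (rword α)} ∪
  {F | ∃ α₁ α₂ : List (Fin m), α = α₁ ++ α₂ ∧ 2 ≤ α₁.length ∧ 1 ≤ α₂.length ∧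
    F = tri.imp (orF (rword α₁) (rword α₂))} ∪
  {F | ∃ α₁ α₂ α₃ : List (Fin m), α = α₁ ++ α₂ ++ α₃ ∧
    2 ≤ α₁.length ∧ 2 ≤ α₂.length ∧ 1 ≤ α₃.length ∧
    F = tri.imp (orF (orF (lword α₁) (rword α₂)) (rword α₃))} ∪
  {F | ∃ α₁ α₂ : List (Fin m), α = α₁ ++ α₂ ∧ 3 ≤ α₁.length ∧ 1 ≤ α₂.length ∧
    F = tri.imp (orF (lword α₁) (rword α₂))}

/-- Code_T(ω)*: substitution instances of codes of words produced from ω by T. -/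
def CodeTStar (T : TagSystem) (ω : List (Fin T.m)) : Set Fm :=
  {F | ∃ β, TagSteps T ω β ∧ F ∈ SubStar (CodeSet β)}

/-- ⟨P⟩: one application of modus ponens or substitution to members of P. -/
def StepSet (P : Set Fm) : Set Fm :=
  {B | ∃ A, A ∈ P ∧ A.imp B ∈ P} ∪ {B | ∃ A ∈ P, ∃ σ : ℕ → Fm, B = Fm.subst σ A}

/-- ⟨P⟩_n. -/
def Stages (P : Set Fm) : ℕ → Set Fm
  | 0 => P
  | n + 1 => StepSet (Stages P n)

theorem E_subst_x0 (σ : ℕ → Fm) (h : σ 0 = x0) (n : ℕ) : (E n).subst σ = E n := by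
  induction n with
  | zero => simp [E, x0, Fm.subst] at h ⊢; exact h
  | succ k ih => simp only [E, Fm.subst, ih, x0]; rw [h]; rfl

theorem code_subst_x0 {m : ℕ} (σ : ℕ → Fm) (h : σ 0 = x0) (a : Fin m) :
    (code a).subst σ = code a := by
  simp only [code, Fm.subst, E_subst_x0 σ h, x0]; rw [h]; rfl

theorem tri_subst_x0 (σ : ℕ → Fm) (h : σ 0 = x0) : tri.subst σ = tri := by
  simp only [tri, Fm.subst, x0]; rw [h]; rfl

theorem R1_step {m : ℕ} {P : Set Fm} (hP : R1Ax m ⊆ P) (a : Fin m) (Y Z U : Fm)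
    (h : Deriv P (tri.imp (orF (orF Y (orF (code a) Z)) U))) :
    Deriv P (tri.imp (orF (orF (orF Y (code a)) Z) U)) := by
  let σ : ℕ → Fm := fun n => match n with
    | 0 => x0
    | 1 => Y
    | 2 => Z
    | _ => U
  have h0 : σ 0 = x0 := rfl
  have h1 := Deriv.subst σ (Deriv.ax (hP ⟨a, rfl⟩))
  simp only [orF, Fm.subst, code_subst_x0 σ h0, tri_subst_x0 σ h0] at h1
  exact Deriv.mp h h1

theorem R1_iter {m : ℕ} {P : Set Fm} (hP : R1Ax m ⊆ P) (U : Fm) (L : List (Fin m)) :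
    ∀ (a : Fin m) (Y : Fm),
      Deriv P (tri.imp (orF (orF Y (rlist ((a :: L).map code))) U)) →
      Deriv P (tri.imp (orF (llistAux Y ((a :: L).map code)) U)) := by
  induction L with
  | nil => intro a Y h; exact h
  | cons b L ih =>
    intro a Y h
    exact ih b (orF Y (code a)) (R1_step hP a Y _ U h)

/-- R1, ▷ → \overrightarrow{ξ} ∨ \overrightarrow{ζ} ⊢ ▷ → \overleftarrow{ξ} ∨ \overrightarrow{ζ},
    for nonempty ξ, ζ. -/
theorem stmt_8 (m : ℕ) (ξ ζ : List (Fin m)) (hξ : ξ ≠ []) (hζ : ζ ≠ []) :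
    Deriv (R1Ax m ∪ {tri.imp (orF (rword ξ) (rword ζ))})
      (tri.imp (orF (lword ξ) (rword ζ))) := by
  have hP : R1Ax m ⊆ R1Ax m ∪ {tri.imp (orF (rword ξ) (rword ζ))} := Set.subset_union_left
  have h0 : Deriv (R1Ax m ∪ {tri.imp (orF (rword ξ) (rword ζ))})
      (tri.imp (orF (rword ξ) (rword ζ))) := Deriv.ax (Or.inr rfl)
  revert hP h0
  generalize R1Ax m ∪ {tri.imp (orF (rword ξ) (rword ζ))} = P
  intro hP h0
  match ξ, hξ with
  | [a], _ => exact h0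
  | a :: b :: L, _ => exact R1_iter hP (rword ζ) L b (code a) h0
end

section
/- For all nonempty words ξ, ζ over 𝒜, the formula ▷ → \overrightarrow{ξζ} is derivable from the set of axioms R2 (for all letters a ∈ 𝒜) together with the formula ▷ → \overleftarrow{ξ} ∨ \overrightarrow{ζ}, by modus ponens and substitution. -/
theorem subst_E (σ : ℕ → Fm) (h : σ 0 = Fm.var 0) (n : ℕ) : (E n).subst σ = E n := by
  induction n with
  | zero => simp [E, x0, Fm.subst, h]
  | succ k ih => simp [E, x0, Fm.subst, h, ih]

theorem subst_code (σ : ℕ → Fm) (h : σ 0 = Fm.var 0) {m : ℕ} (a : Fin m) :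
    (code a).subst σ = code a := by
  simp [code, x0, Fm.subst, h, subst_E]

theorem deriv_R2 {m : ℕ} {P : Set Fm} (hP : R2Ax m ⊆ P) (a : Fin m) (Y Z : Fm)
    (h : Deriv P (tri.imp (orF (orF Y (code a)) Z))) :
    Deriv P (tri.imp (orF Y (orF (code a) Z))) := by
  let σ : ℕ → Fm := fun n => if n = 0 then Fm.var 0 else if n = 1 then Y else Z
  have h0 : σ 0 = Fm.var 0 := rfl
  have h1 : σ 1 = Y := rfl
  have h2 : σ 2 = Z := rfl
  have key := Deriv.subst σ (Deriv.ax (hP ⟨a, rfl⟩))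
  simp only [orF, tri, x0, Fm.subst, h0, h1, h2, subst_code σ h0] at key
  exact Deriv.mp h key

theorem llistAux_append (A : Fm) (l : List Fm) (B : Fm) :
    llistAux A (l ++ [B]) = orF (llistAux A l) B := by
  induction l generalizing A with
  | nil => rfl
  | cons C l ih => exact ih _

theorem rword_cons {m : ℕ} (a : Fin m) (w : List (Fin m)) (hw : w ≠ []) :
    rword (a :: w) = orF (code a) (rword w) := by
  cases w with
  | nil => exact absurd rfl hw
  | cons b w => rfl

theorem deriv_shift {m : ℕ} {P : Set Fm} (hP : R2Ax m ⊆ P) (a : Fin m) (ξ : List (Fin m)) :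
    ∀ ζ : List (Fin m), ζ ≠ [] →
      Deriv P (tri.imp (orF (lword (a :: ξ)) (rword ζ))) →
      Deriv P (tri.imp (rword (a :: ξ ++ ζ))) := by
  induction ξ using List.reverseRecOn with
  | nil =>
    intro ζ hζ h
    have e : rword ([a] ++ ζ) = orF (code a) (rword ζ) := rword_cons a ζ hζ
    rw [e]
    exact h
  | append_singleton l b ih =>
    intro ζ hζ h
    have e : lword (a :: (l ++ [b])) = orF (lword (a :: l)) (code b) := by
      simp [lword, llist, llistAux_append]
    rw [e] at h
    have h' := deriv_R2 hP b _ _ h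
    rw [← rword_cons b ζ hζ] at h'
    have := ih (b :: ζ) (by simp) h'
    simpa using this

/-- R2, ▷ → \overleftarrow{ξ} ∨ \overrightarrow{ζ} ⊢ ▷ → \overrightarrow{ξζ},
    for nonempty ξ, ζ. -/
theorem stmt_9 (m : ℕ) (ξ ζ : List (Fin m)) (hξ : ξ ≠ []) (hζ : ζ ≠ []) :
    Deriv (R2Ax m ∪ {tri.imp (orF (lword ξ) (rword ζ))})
      (tri.imp (rword (ξ ++ ζ))) := by
  cases ξ with
  | nil => exact absurd rfl hξ
  | cons a l =>
    exact deriv_shift Set.subset_union_left a l ζ hζ (Deriv.ax (Or.inr rfl))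
end

section
/- Let T = ⟨𝒜, 𝒲, d⟩ be a tag system with all words ω_i nonempty, ω a nonempty word over 𝒜, and P₀ a finite set of formulas in which the variable x⁰ does not occur. If T halts on the input word ω, then every formula derivable from P₀ is derivable from P_{T,ω,P₀} (i.e., P₀ ≤ P_{T,ω,P₀}). -/
/-- The substitution sending variables 1, 2, 3 to given formulas. -/
def sub3 (Y Z U : Fm) : ℕ → Fm
  | 1 => Y
  | 2 => Z
  | 3 => U
  | n => Fm.var n

lemma subst_x0 (Y Z U : Fm) : x0.subst (sub3 Y Z U) = x0 := rfl

lemma subst_E_s17 (Y Z U : Fm) (n : ℕ) : (E n).subst (sub3 Y Z U) = E n := by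
  induction n with
  | zero => rfl
  | succ n ih => simp [E, Fm.subst, ih, subst_x0]

lemma subst_code_s17 {m : ℕ} (Y Z U : Fm) (i : Fin m) :
    (code i).subst (sub3 Y Z U) = code i := by
  simp [code, Fm.subst, subst_E_s17, subst_x0]

lemma subst_tri (Y Z U : Fm) : tri.subst (sub3 Y Z U) = tri := rfl

lemma subst_orF (σ : ℕ → Fm) (A B : Fm) :
    (orF A B).subst σ = orF (A.subst σ) (B.subst σ) := rfl

lemma subst_rlist (Y Z U : Fm) (l : List Fm) :
    (rlist l).subst (sub3 Y Z U) = rlist (l.map (Fm.subst (sub3 Y Z U))) := by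
  induction l with
  | nil => rfl
  | cons A l ih =>
    cases l with
    | nil => rfl
    | cons B l =>
      simp only [rlist, List.map_cons, subst_orF] at ih ⊢
      rw [ih]

lemma subst_map_code {m : ℕ} (Y Z U : Fm) (w : List (Fin m)) :
    (w.map code).map (Fm.subst (sub3 Y Z U)) = w.map code := by
  simp [List.map_map, Function.comp_def, subst_code_s17]

lemma rlist_cons (A : Fm) (l : List Fm) (h : l ≠ []) : rlist (A :: l) = orF A (rlist l) := by
  cases l with
  | nil => exact absurd rfl h
  | cons B l => rfl

lemma rlist_append (l k : List Fm) (h : k ≠ []) : rlist (l ++ [rlist k]) = rlist (l ++ k) := by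
  induction l with
  | nil => rfl
  | cons A l ih =>
    rw [List.cons_append, List.cons_append, rlist_cons _ _ (by simp),
      rlist_cons _ _ (by simp [h]), ih]

lemma use_R1 {P : Set Fm} {m : ℕ} (hR1 : R1Ax m ⊆ P) (Y Z U : Fm) (a : Fin m)
    (h : Deriv P (tri.imp (orF (orF Y (orF (code a) Z)) U))) :
    Deriv P (tri.imp (orF (orF (orF Y (code a)) Z) U)) := by
  have h2 := Deriv.subst (sub3 Y Z U) (Deriv.ax (hR1 ⟨a, rfl⟩))
  simp only [Fm.subst, subst_tri, subst_orF, subst_code_s17, sub3] at h2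
  exact Deriv.mp h h2

lemma use_R2 {P : Set Fm} {m : ℕ} (hR2 : R2Ax m ⊆ P) (Y Z : Fm) (a : Fin m)
    (h : Deriv P (tri.imp (orF (orF Y (code a)) Z))) :
    Deriv P (tri.imp (orF Y (orF (code a) Z))) := by
  have h2 := Deriv.subst (sub3 Y Z x0) (Deriv.ax (hR2 ⟨a, rfl⟩))
  simp only [Fm.subst, subst_tri, subst_orF, subst_code_s17, sub3] at h2
  exact Deriv.mp h h2

lemma loop_R1 {P : Set Fm} {m : ℕ} (hR1 : R1Ax m ⊆ P) (U : Fm) (w : List (Fin m)) :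
    ∀ (Y : Fm) (b : Fin m),
      Deriv P (tri.imp (orF (orF Y (rlist ((b :: w).map code))) U)) →
      Deriv P (tri.imp (orF (llistAux Y ((b :: w).map code)) U)) := by
  induction w with
  | nil => intro Y b h; exact h
  | cons c w ih =>
    intro Y b h
    exact ih _ c (use_R1 hR1 _ _ _ b h)

lemma loop_R2 {P : Set Fm} {m : ℕ} (hR2 : R2Ax m ⊆ P) (U : Fm) (w : List (Fin m)) :
    ∀ (Y : Fm),
      Deriv P (tri.imp (orF (llistAux Y (w.map code)) U)) →
      Deriv P (tri.imp (orF Y (rlist (w.map code ++ [U])))) := by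
  induction w with
  | nil => intro Y h; exact h
  | cons c w ih =>
    intro Y h
    have h2 := use_R2 hR2 _ _ c (ih _ h)
    rw [List.map_cons, List.cons_append, rlist_cons _ _ (by simp)]
    exact h2

lemma merge_words {P : Set Fm} {m : ℕ} (hR1 : R1Ax m ⊆ P) (hR2 : R2Ax m ⊆ P)
    (γ δ : List (Fin m)) (hγ : γ ≠ []) (hδ : δ ≠ [])
    (h : Deriv P (tri.imp (orF (rword γ) (rword δ)))) :
    Deriv P (tri.imp (rword (γ ++ δ))) := by
  have hδ' : δ.map code ≠ [] := by simpa using hδ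
  cases γ with
  | nil => exact absurd rfl hγ
  | cons a γ =>
    have key : Deriv P (tri.imp (orF (llistAux (code a) (γ.map code)) (rword δ))) := by
      cases γ with
      | nil => exact h
      | cons b γ => exact loop_R1 hR1 _ _ _ _ h
    have h2 := loop_R2 hR2 _ _ _ key
    rw [rword, rlist_append _ _ hδ'] at h2
    rw [rword, List.map_append, List.map_cons, List.cons_append, rlist_cons _ _ (by simp [hδ])]
    exact h2

lemma step_deriv {P : Set Fm} (T : TagSystem) (hW : ∀ i, T.W i ≠ []) (hP : PT T ⊆ P)
    {ξ ζ : List (Fin T.m)} (hs : TagStep T ξ ζ) (h : Deriv P (tri.imp (rword ξ))) :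
    Deriv P (tri.imp (rword ζ)) := by
  obtain ⟨i, β, γ, hβ, rfl, rfl⟩ := hs
  by_cases hγ : γ = []
  · subst hγ
    have h2 : Deriv P ((tri.imp (rword (i :: β))).imp (tri.imp (rword (T.W i)))) :=
      Deriv.ax (hP (Or.inl (Or.inl (Or.inr ⟨i, β, hβ, rfl⟩))))
    rw [List.append_nil] at h
    exact Deriv.mp h h2
  · have hWi : (T.W i).map code ≠ [] := by simpa using hW i
    have hγ' : γ.map code ≠ [] := by simpa using hγ
    have h2 := Deriv.subst (sub3 (rword γ) x0 x0) (Deriv.ax (P := P)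
      (hP (Or.inl (Or.inl (Or.inl ⟨i, β, hβ, rfl⟩)))))
    simp only [Fm.subst, subst_tri, subst_rlist, List.map_append, subst_map_code,
      List.map_cons, List.map_nil, sub3, subst_code_s17] at h2
    rw [rlist_cons _ _ hWi, rword, ← List.map_cons (f := code), rlist_append _ _ hγ',
      ← List.map_append] at h2
    refine merge_words (fun F hF => hP (Or.inl (Or.inr hF))) (fun F hF => hP (Or.inr hF))
      γ (T.W i) hγ (hW i) (Deriv.mp h h2)

/-- If T halts on ω then P₀ ≤ P_{T,ω,P₀}. -/
theorem stmt_17 (T : TagSystem) (hW : ∀ i, T.W i ≠ []) (hd : 1 ≤ T.d)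
    (ω : List (Fin T.m)) (hω : ω ≠ []) (P₀ : Finset Fm)
    (hx0 : ∀ A ∈ P₀, ¬ Occurs 0 A)
    (hHalt : Halts T ω) (A : Fm) (h : Deriv (↑P₀) A) :
    Deriv (PTot T ω P₀) A := by
  have hsteps : ∀ β, TagSteps T ω β → β ≠ [] ∧ Deriv (PTot T ω P₀) (tri.imp (rword β)) := by
    intro β hβ
    induction hβ with
    | refl => exact ⟨hω, Deriv.ax (Or.inl rfl)⟩
    | tail _ hs ih =>
      refine ⟨?_, step_deriv T hW (fun F hF => Or.inr (Or.inl hF)) hs ih.2⟩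
      obtain ⟨i, β, γ, _, _, rfl⟩ := hs
      simp [hW i]
  obtain ⟨β, hβ, hlen⟩ := hHalt
  obtain ⟨hne, hder⟩ := hsteps β hβ
  induction h with
  | ax hA =>
    exact Deriv.mp hder (Deriv.ax (Or.inr (Or.inr
      ⟨β, _, List.length_pos_iff.mpr hne, hlen, hA, rfl⟩)))
  | mp _ _ ih1 ih2 => exact Deriv.mp ih1 ih2
  | subst σ _ ih => exact Deriv.subst σ ih
end
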